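/- Let P(x) = ∑_{1 ≤ |α| ≤ d} λ_α x^α be a real polynomial on ℝⁿ of degree at most d with no constant term, and write |λ| = ∑_{1 ≤ |α| ≤ d} |λ_α|. Then there is a constant C depending only on n and d (not on the coefficients λ) such that for every ε > 0, the Lebesgue measure of the sublevel set {x ∈ U : |P(x)| ≤ ε} is at most C ε^{1/d} |λ|^{-1/d}, where U is the closed unit ball in ℝⁿ. -/

import Mathlib

open MeasureTheory Set

/-- Degree of a multi-index `α : Fin n → Fin (d+1)`. -/
def mdeg {n d : ℕ} (α : Fin n → Fin (d + 1)) : ℕ := ∑ i, (α i : ℕ)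

/-- The polynomial `P(x) = ∑_α λ_α x^α`. -/
noncomputable def mpoly {n d : ℕ} (lam : (Fin n → Fin (d + 1)) → ℝ)
    (x : EuclideanSpace ℝ (Fin n)) : ℝ :=
  ∑ α : Fin n → Fin (d + 1), lam α * ∏ i, x i ^ (α i : ℕ)

lemma exists_sep (F : Set ℝ) (δ : ℝ) (d : ℕ)
    (hF : (d : ENNReal) * ENNReal.ofReal (2 * δ) < volume F) :
    ∀ k ≤ d + 1, ∃ T : Finset ℝ, T.card = k ∧ (∀ t ∈ T, t ∈ F) ∧
      ∀ a ∈ T, ∀ b ∈ T, a ≠ b → δ ≤ |a - b| := by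
  intro k
  induction k with
  | zero => intro _; exact ⟨∅, by simp⟩
  | succ k ih =>
    intro hk
    obtain ⟨T, hc, hT, hs⟩ := ih (by omega)
    have : ¬ F ⊆ ⋃ t ∈ T, Metric.ball t δ := by
      intro h
      have h1 : volume F ≤ ∑ t ∈ T, volume (Metric.ball t δ) :=
        (measure_mono h).trans (measure_biUnion_finset_le _ _)
      simp only [Real.volume_ball, Finset.sum_const, hc, nsmul_eq_mul] at h1
      have h2 : (k : ENNReal) * ENNReal.ofReal (2 * δ) ≤ d * ENNReal.ofReal (2 * δ) := by
        gcongr; omega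
      exact absurd hF (not_lt.2 (h1.trans h2))
    obtain ⟨x, hxF, hx⟩ := Set.not_subset.1 this
    simp only [Set.mem_iUnion, Metric.mem_ball, Real.dist_eq, not_exists, not_lt] at hx
    by_cases hxT : x ∈ T
    · have := hx x hxT
      simp at this
      by_cases h0 : δ ≤ 0
      · obtain ⟨T, hT1, hT2⟩ : ∃ T : Finset ℝ, ↑T ⊆ F ∧ T.card = k + 1 := by
          have hinf : F.Infinite := by
            intro hfin
            rw [hfin.measure_zero] at hF
            simp at hF
          obtain ⟨T, h1, h2⟩ := hinf.exists_subset_card_eq (k + 1)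
          exact ⟨T, h1, h2⟩
        exact ⟨T, hT2, fun t ht => hT1 ht, fun a _ b _ _ => h0.trans (abs_nonneg _)⟩
      · exact absurd this h0
    · refine ⟨insert x T, by rw [Finset.card_insert_of_notMem hxT, hc], ?_, ?_⟩
      · intro t ht
        rcases Finset.mem_insert.1 ht with rfl | ht
        · exact hxF
        · exact hT t ht
      · intro a ha b hb hab
        rcases Finset.mem_insert.1 ha with hax | ha2 <;> rcases Finset.mem_insert.1 hb with hbx | hb2
        · exact absurd (hax.trans hbx.symm) hab
        · rw [hax]; exact hx b hb2
        · rw [hbx, abs_sub_comm]; exact hx a ha2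
        · exact hs a ha2 b hb2 hab

lemma one_dim (d : ℕ) (q : Polynomial ℝ) (hq : q.natDegree ≤ d) (ε δ : ℝ)
    (hδ : 0 < δ) (hM : (d + 1) * ε * (2 / δ) ^ d < |q.eval 0|) :
    volume {s : ℝ | s ∈ Icc (1:ℝ) 2 ∧ |q.eval s| ≤ ε} ≤ d * ENNReal.ofReal (2 * δ) := by
  by_contra hcon
  obtain ⟨T, hc, hT, hs⟩ := exists_sep _ δ d (not_le.1 hcon) (d + 1) le_rfl
  have hinterp : q = Lagrange.interpolate T id (fun i => q.eval (id i)) := by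
    apply Lagrange.eq_interpolate (Set.injOn_id _)
    rw [hc]
    exact lt_of_le_of_lt Polynomial.degree_le_natDegree (by exact_mod_cast Nat.lt_succ_of_le hq)
  have hval : q.eval 0 = ∑ j ∈ T, q.eval j * ∏ i ∈ T.erase j, ((j - i)⁻¹ * (0 - i)) := by
    conv_lhs => rw [hinterp]
    simp [Lagrange.interpolate_apply, Polynomial.eval_finsetSum, Lagrange.basis,
      Lagrange.basisDivisor, Polynomial.eval_prod]
  refine absurd hM (not_lt.2 ?_)
  rw [hval]
  calc _ ≤ ∑ j ∈ T, |q.eval j * ∏ i ∈ T.erase j, ((j - i)⁻¹ * (0 - i))| :=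
        Finset.abs_sum_le_sum_abs _ _
    _ ≤ ∑ j ∈ T, ε * (2 / δ) ^ d := by
        apply Finset.sum_le_sum
        intro j hj
        have hε : 0 ≤ ε := (abs_nonneg _).trans (hT j hj).2
        rw [abs_mul, Finset.abs_prod]
        refine mul_le_mul (hT j hj).2 ?_ (Finset.prod_nonneg fun _ _ => abs_nonneg _) hε
        have hcard : (T.erase j).card = d := by rw [Finset.card_erase_of_mem hj, hc]; rfl
        rw [← hcard, ← Finset.prod_const]
        apply Finset.prod_le_prod (fun _ _ => abs_nonneg _)
        intro i hi
        obtain ⟨hij, hi⟩ := Finset.mem_erase.1 hi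
        have h1 := hs j hj i hi hij.symm
        have h2 := (hT i hi).1
        rw [abs_mul, abs_inv, zero_sub, abs_neg, inv_mul_eq_div, abs_of_nonneg (by linarith [h2.1] : (0:ℝ) ≤ i)]
        gcongr
        exact h2.2
    _ = (d + 1) * ε * (2 / δ) ^ d := by
        rw [Finset.sum_const, hc, nsmul_eq_mul]; push_cast; ring

/-- grid points -/
noncomputable def gpt {n d : ℕ} (v : Fin n → Fin (d + 1)) : EuclideanSpace ℝ (Fin n) :=
  WithLp.toLp 2 (fun i => ((v i : ℕ) : ℝ))

noncomputable def evL (n d : ℕ) :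
    ((Fin n → Fin (d + 1)) → ℝ) →ₗ[ℝ] ((Fin n → Fin (d + 1)) → ℝ) where
  toFun lam v := mpoly lam (gpt v)
  map_add' a b := by ext v; simp [mpoly, add_mul, Finset.sum_add_distrib]
  map_smul' a b := by ext v; simp [mpoly, Finset.mul_sum, mul_assoc]

lemma evL_ker (n d : ℕ) : LinearMap.ker (evL n d) = ⊥ := by
  rw [LinearMap.ker_eq_bot']
  intro lam h
  let e : (Fin n → Fin (d + 1)) → (Fin n →₀ ℕ) :=
    fun α => Finsupp.equivFunOnFinite.symm (fun i => (α i : ℕ))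
  have he : Function.Injective e := by
    intro a b hab
    ext i
    have := DFunLike.congr_fun hab i
    simpa [e] using this
  let p : MvPolynomial (Fin n) ℝ := ∑ α, MvPolynomial.monomial (e α) (lam α)
  have hev : ∀ x : Fin n → ℝ, MvPolynomial.eval x p = ∑ α, lam α * ∏ i, x i ^ (α i : ℕ) := by
    intro x
    simp only [p, map_sum, MvPolynomial.eval_monomial]
    refine Finset.sum_congr rfl fun α _ => ?_
    rw [Finsupp.prod_fintype _ _ (by simp)]
    simp [e]
  have hp : p = 0 := by
    apply MvPolynomial.eq_zero_of_eval_zero_at_prod_finset p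
      (fun _ => (Finset.range (d + 1)).image (fun k : ℕ => (k : ℝ)))
    · intro i
      rw [Finset.card_image_of_injective _ Nat.cast_injective, Finset.card_range]
      apply Nat.lt_succ_of_le
      refine (MvPolynomial.degreeOf_sum_le _ _ _).trans ?_
      refine Finset.sup_le fun α _ => ?_
      by_cases h0 : lam α = 0
      · simp [h0]
      · rw [MvPolynomial.degreeOf_monomial_eq _ _ h0]
        simp [e]; omega
    · intro x hx
      choose k hk hkx using fun i => Finset.mem_image.1 (hx i)
      have := congrFun h (fun i => ⟨k i, Finset.mem_range.1 (hk i)⟩)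
      rw [hev]
      simpa [evL, mpoly, gpt, hkx] using this
  ext α
  have := congrArg (MvPolynomial.coeff (e α)) hp
  simpa [p, MvPolynomial.coeff_sum, MvPolynomial.coeff_monomial, he.eq_iff] using this

lemma exists_pt (n d : ℕ) : ∃ c : ℝ, 0 < c ∧ ∀ lam : (Fin n → Fin (d + 1)) → ℝ,
    0 < ∑ α, |lam α| → ∃ v : Fin n → Fin (d + 1), c * ∑ α, |lam α| ≤ |mpoly lam (gpt v)| := by
  obtain ⟨K, hK, hL⟩ := (evL n d).exists_antilipschitzWith (evL_ker n d)
  set N : ℝ := (Fintype.card (Fin n → Fin (d + 1)) : ℝ) with hN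
  have hNpos : 0 < N := by rw [hN]; exact_mod_cast Fintype.card_pos
  have hKp : (0:ℝ) < K := by exact_mod_cast hK
  refine ⟨(N * K)⁻¹, by positivity, ?_⟩
  intro lam hS
  by_contra hcon
  push Not at hcon
  have h1 : ‖evL n d lam‖ < (N * K)⁻¹ * ∑ α, |lam α| := by
    rw [pi_norm_lt_iff (by positivity)]
    exact hcon
  have h2 : ‖lam‖ ≤ K * ‖evL n d lam‖ := by
    have := hL.le_mul_dist lam 0
    simpa using this
  have h3 : ∑ α, |lam α| ≤ N * ‖lam‖ := by
    calc _ ≤ ∑ α : Fin n → Fin (d + 1), ‖lam‖ := Finset.sum_le_sum fun α _ => norm_le_pi_norm lam α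
      _ = _ := by simp [hN]
  have h4 : N * ‖lam‖ ≤ N * K * ‖evL n d lam‖ := by
    rw [mul_assoc]; gcongr
  have h5 : N * K * ‖evL n d lam‖ < N * K * ((N * K)⁻¹ * ∑ α, |lam α|) := by gcongr
  rw [mul_inv_cancel_left₀ (by positivity)] at h5
  linarith

lemma exists_poly {n d : ℕ} (lam : (Fin n → Fin (d + 1)) → ℝ)
    (hl : ∀ α, (mdeg α < 1 ∨ d < mdeg α) → lam α = 0) (x y : EuclideanSpace ℝ (Fin n)) :
    ∃ q : Polynomial ℝ, q.natDegree ≤ d ∧ ∀ s : ℝ, q.eval s = mpoly lam (x + s • y) := by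
  refine ⟨∑ α, Polynomial.C (lam α) *
    ∏ i, (Polynomial.C (y i) * Polynomial.X + Polynomial.C (x i)) ^ (α i : ℕ), ?_, ?_⟩
  · apply Polynomial.natDegree_sum_le_of_forall_le
    intro α _
    by_cases h : d < mdeg α
    · simp [hl α (Or.inr h)]
    · refine (Polynomial.natDegree_C_mul_le _ _).trans ((Polynomial.natDegree_prod_le _ _).trans ?_)
      refine le_trans ?_ (not_lt.1 h)
      apply Finset.sum_le_sum
      intro i _
      refine (Polynomial.natDegree_pow_le).trans ?_
      exact (Nat.mul_le_mul_left _ Polynomial.natDegree_linear_le).trans (by simp)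
  · intro s
    simp only [Polynomial.eval_finsetSum, Polynomial.eval_mul, Polynomial.eval_C,
      Polynomial.eval_prod, Polynomial.eval_pow, Polynomial.eval_add, Polynomial.eval_X, mpoly,
      PiLp.add_apply, PiLp.smul_apply, smul_eq_mul]
    refine Finset.sum_congr rfl fun α _ => ?_
    congr 1
    refine Finset.prod_congr rfl fun i _ => ?_
    congr 1
    ring

lemma dilate {n : ℕ} (E : Set (EuclideanSpace ℝ (Fin n))) (hE : MeasurableSet E)
    (hE1 : E ⊆ Metric.closedBall 0 1) (x : EuclideanSpace ℝ (Fin n)) (R : ℝ) (hx : ‖x‖ ≤ R)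
    (B : ENNReal) (hB : ∀ y, volume {s : ℝ | s ∈ Icc (1:ℝ) 2 ∧ x + s • y ∈ E} ≤ B) :
    volume E ≤ 2 ^ n * (B * volume (Metric.closedBall (0 : EuclideanSpace ℝ (Fin n)) (1 + R))) := by
  let A : Set (ℝ × EuclideanSpace ℝ (Fin n)) := {p | p.1 ∈ Icc (1:ℝ) 2 ∧ x + p.1 • p.2 ∈ E}
  have hA : MeasurableSet A := by
    apply MeasurableSet.inter
    · exact measurable_fst measurableSet_Icc
    · have : Continuous fun p : ℝ × EuclideanSpace ℝ (Fin n) => x + p.1 • p.2 := by fun_prop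
      exact this.measurable hE
  have h1 : (volume.prod volume) A ≤
      B * volume (Metric.closedBall (0 : EuclideanSpace ℝ (Fin n)) (1 + R)) := by
    rw [Measure.prod_apply_symm hA, ← lintegral_indicator_const Metric.isClosed_closedBall.measurableSet]
    apply lintegral_mono
    intro y
    by_cases hy : y ∈ Metric.closedBall (0 : EuclideanSpace ℝ (Fin n)) (1 + R)
    · simp only [Set.indicator_of_mem hy]
      exact hB y
    · simp only [Set.indicator_of_notMem hy, nonpos_iff_eq_zero]
      convert measure_empty (μ := volume)
      ext s
      simp only [A, mem_preimage, mem_ofPred_eq, mem_empty_iff_false, iff_false, not_and]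
      intro hs hmem
      apply hy
      have h := hE1 hmem
      rw [mem_closedBall_zero_iff] at h ⊢
      have h2 : ‖s • y‖ ≤ 1 + R := by
        calc ‖s • y‖ = ‖(x + s • y) - x‖ := by simp
          _ ≤ ‖x + s • y‖ + ‖x‖ := norm_sub_le _ _
          _ ≤ _ := by gcongr
      rw [norm_smul, Real.norm_of_nonneg (by linarith [hs.1])] at h2
      nlinarith [norm_nonneg y, hs.1]
  have h2 : volume E ≤ 2 ^ n * (volume.prod volume) A := by
    rw [Measure.prod_apply hA, ← lintegral_const_mul _ (measurable_measure_prodMk_left hA)]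
    calc volume E = volume E * volume (Icc (1:ℝ) 2) := by
          rw [Real.volume_Icc]; norm_num
      _ = ∫⁻ s, (Icc (1:ℝ) 2).indicator (fun _ => volume E) s := by
          rw [lintegral_indicator_const measurableSet_Icc]
      _ ≤ _ := by
          apply lintegral_mono
          intro s
          by_cases hs : s ∈ Icc (1:ℝ) 2
          · simp only [Set.indicator_of_mem hs]
            have hs0 : (0:ℝ) < s := by linarith [hs.1]
            have heq : Prod.mk s ⁻¹' A = (fun y => s • y) ⁻¹' ((fun z => x + z) ⁻¹' E) := by
              ext y
              simp [A, hs.1, hs.2]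
            rw [heq, Measure.addHaar_preimage_smul _ hs0.ne', measure_preimage_add, ← mul_assoc]
            refine le_mul_of_one_le_left zero_le ?_
            rw [finrank_euclideanSpace_fin, abs_of_pos (by positivity)]
            have : (2:ENNReal) ^ n = ENNReal.ofReal (2 ^ n) := by
              rw [ENNReal.ofReal_pow (by norm_num)]; norm_num
            rw [this, ← ENNReal.ofReal_mul (by positivity), ENNReal.one_le_ofReal,
              ← div_eq_mul_inv, one_le_div (by positivity)]
            exact pow_le_pow_left₀ hs0.le hs.2 n
          · simp [Set.indicator_of_notMem hs]
  exact h2.trans (by gcongr)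

/-- sublevel-set van der Corput estimate: for `P(x) = ∑_{1≤|α|≤d} λ_α x^α`,
`|{x ∈ U : |P(x)| ≤ ε}| ≤ C ε^{1/d} |λ|^{-1/d}` with `C = C(n,d)`. -/
theorem stmt4 (n d : ℕ) (hd : 1 ≤ d) :
    ∃ C : ℝ, 0 < C ∧ ∀ lam : (Fin n → Fin (d + 1)) → ℝ,
      (∀ α, (mdeg α < 1 ∨ d < mdeg α) → lam α = 0) →
      (0 < ∑ α : Fin n → Fin (d + 1), |lam α|) →
      ∀ ε : ℝ, 0 < ε →
        volume {x : EuclideanSpace ℝ (Fin n) |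
            x ∈ Metric.closedBall (0 : EuclideanSpace ℝ (Fin n)) 1 ∧ |mpoly lam x| ≤ ε}
          ≤ ENNReal.ofReal (C * ε ^ (1 / (d:ℝ)) *
              (∑ α : Fin n → Fin (d + 1), |lam α|) ^ (-(1 / (d:ℝ)))) := by
  obtain ⟨c, hc, hpt⟩ := exists_pt n d
  obtain ⟨R, hR⟩ : ∃ R : ℝ, ∀ v : Fin n → Fin (d + 1), ‖gpt v‖ ≤ R := by
    obtain ⟨R, hR⟩ := (Set.finite_range fun v : Fin n → Fin (d + 1) => ‖gpt v‖).bddAbove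
    exact ⟨R, fun v => hR ⟨v, rfl⟩⟩
  set V := (volume (Metric.closedBall (0 : EuclideanSpace ℝ (Fin n)) (1 + R))).toReal with hV
  have hVe : volume (Metric.closedBall (0 : EuclideanSpace ℝ (Fin n)) (1 + R)) =
      ENNReal.ofReal V := (ENNReal.ofReal_toReal measure_closedBall_lt_top.ne).symm
  have hV0 : 0 ≤ V := ENNReal.toReal_nonneg
  have hdR : (1:ℝ) ≤ d := by exact_mod_cast hd
  refine ⟨2 ^ n * (d * (2 * (4 * (d + 1) * c ^ (-(1 / (d:ℝ)))))) * (V + 1), by positivity, ?_⟩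
  intro lam hl hS ε hε
  obtain ⟨v, hv⟩ := hpt lam hS
  set S := ∑ α, |lam α| with hSdef
  set r : ℝ := ε ^ (1 / (d:ℝ)) * (c ^ (-(1 / (d:ℝ))) * S ^ (-(1 / (d:ℝ)))) with hr
  have hr0 : 0 < r := by positivity
  have hrd : r ^ d = ε / (c * S) := by
    have key : ∀ a : ℝ, 0 < a → (a ^ (1 / (d:ℝ))) ^ d = a := by
      intro a ha
      rw [one_div]
      exact Real.rpow_inv_natCast_pow ha.le (by omega)
    rw [hr, Real.rpow_neg hc.le, Real.rpow_neg hS.le, mul_pow, mul_pow, inv_pow, inv_pow,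
      key _ hε, key _ hc, key _ hS]
    field_simp
  set δ : ℝ := 4 * (d + 1) * r with hδ
  have hδ0 : 0 < δ := by positivity
  have hcond : (d + 1) * ε * (2 / δ) ^ d < c * S := by
    have e1 : 2 / δ = (2 * ((d:ℝ) + 1))⁻¹ * r⁻¹ := by rw [hδ]; field_simp; norm_num
    rw [e1, mul_pow, inv_pow, inv_pow, hrd]
    have e2 : (d:ℝ) + 1 < (2 * ((d:ℝ) + 1)) ^ d := by
      have := le_self_pow₀ (by linarith : 1 ≤ 2 * ((d:ℝ) + 1)) (by omega : d ≠ 0)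
      linarith
    have e3 : ((d:ℝ) + 1) * ε * (((2 * ((d:ℝ) + 1)) ^ d)⁻¹ * (ε / (c * S))⁻¹) =
        ((d:ℝ) + 1) / (2 * ((d:ℝ) + 1)) ^ d * (c * S) := by
      field_simp
    rw [e3]
    have : ((d:ℝ) + 1) / (2 * ((d:ℝ) + 1)) ^ d < 1 := by
      rw [div_lt_one (by positivity)]; exact e2
    have hcS : 0 < c * S := by positivity
    nlinarith
  have hcont : Continuous fun x : EuclideanSpace ℝ (Fin n) => |mpoly lam x| := by
    unfold mpoly; fun_prop
  have hmeas : MeasurableSet {x : EuclideanSpace ℝ (Fin n) |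
      x ∈ Metric.closedBall (0 : EuclideanSpace ℝ (Fin n)) 1 ∧ |mpoly lam x| ≤ ε} :=
    (Metric.isClosed_closedBall.inter (isClosed_le hcont continuous_const)).measurableSet
  refine (dilate _ hmeas (fun x hx => hx.1) (gpt v) R (hR v) (d * ENNReal.ofReal (2 * δ)) ?_).trans ?_
  · intro y
    obtain ⟨q, hq, hqe⟩ := exists_poly lam hl (gpt v) y
    refine le_trans (measure_mono ?_) (one_dim d q hq ε δ hδ0 ?_)
    · rintro s ⟨hs, hs2⟩
      exact ⟨hs, by rw [hqe]; exact hs2.2⟩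
    · rw [hqe]
      simpa using hcond.trans_le hv
  · rw [hVe]
    have t1 : (2:ENNReal) ^ n = ENNReal.ofReal (2 ^ n) := by
      rw [ENNReal.ofReal_pow (by norm_num)]; norm_num
    have t2 : (d:ENNReal) = ENNReal.ofReal d := by simp
    rw [t1, t2, ← ENNReal.ofReal_mul (by positivity), ← ENNReal.ofReal_mul (by positivity),
      ← ENNReal.ofReal_mul (by positivity)]
    apply ENNReal.ofReal_le_ofReal
    have : 2 ^ n * (↑d * (2 * (4 * (↑d + 1) * c ^ (-(1 / (d:ℝ)))))) * (V + 1) * ε ^ (1 / (d:ℝ)) *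
        S ^ (-(1 / (d:ℝ))) = 2 ^ n * (d * (2 * δ) * (V + 1)) := by
      rw [hδ, hr]; ring
    rw [this]
    gcongr
    linarith
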